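/- Let α, β be finite types, n ≥ 2, and let {(η i, ρ i)}_{i ∈ Fin n} be an ensemble of density matrices on Matrix (α × β) (α × β) ℂ. Suppose there exists Q < 2/n such that ∑ i, η i * (Tr (Γ(ρ i) * N i)).re ≤ Q for every POVM N with n outcomes on the single-copy space. For each L ≥ 1 define q_L := sSup { ∑ i, η_i^{(L)} * (Tr (Γ(ρ_i^{(L)}) * M i)).re | M a POVM with n outcomes on the L-fold space (indexed by Fin L → α × β) }. Then the sequence (q_L) tends to 1/n as L → ∞. -/

import Mathlib

open Matrix BigOperators
open scoped ComplexOrder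

/-- A POVM with `n` outcomes: each element is positive semidefinite and they sum to the identity. -/
def IsPOVM {ι : Type*} [Fintype ι] [DecidableEq ι] {n : ℕ} (M : Fin n → Matrix ι ι ℂ) : Prop :=
  (∀ i, (M i).PosSemidef) ∧ ∑ i, M i = 1

/-- Partial transposition (with respect to the second subsystem) on a bipartite system. -/
def ptAB {α β : Type*} (ρ : Matrix (α × β) (α × β) ℂ) : Matrix (α × β) (α × β) ℂ :=
  Matrix.of fun p q => ρ (p.1, q.2) (q.1, p.2)

/-- Probability of the string `c` in the `L`-fold ensemble. -/
def etaC {n : ℕ} (L : ℕ) (η : Fin n → ℝ) (c : Fin L → Fin n) : ℝ := ∏ l, η (c l)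

/-- The `L`-fold tensor-product state labelled by the string `c`. -/
def rhoC {ι : Type*} {n : ℕ} (L : ℕ) (ρ : Fin n → Matrix ι ι ℂ) (c : Fin L → Fin n) :
    Matrix (Fin L → ι) (Fin L → ι) ℂ :=
  Matrix.of fun x y => ∏ l, ρ (c l) (x l) (y l)

/-- The modulo-`n` sum of the entries of `c`. -/
def omg {n : ℕ} (L : ℕ) (hn : 0 < n) (c : Fin L → Fin n) : Fin n :=
  ⟨(∑ l, (c l).val) % n, Nat.mod_lt _ hn⟩

/-- The probability `η_i^{(L)}` of the grouped `L`-fold ensemble. -/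
def etaL {n : ℕ} (L : ℕ) (hn : 0 < n) (η : Fin n → ℝ) (i : Fin n) : ℝ :=
  ∑ c ∈ Finset.univ.filter (fun c : Fin L → Fin n => omg L hn c = i), etaC L η c

/-- The state `ρ_i^{(L)}` of the grouped `L`-fold ensemble. -/
noncomputable def rhoL {ι : Type*} {n : ℕ} (L : ℕ) (hn : 0 < n) (η : Fin n → ℝ)
    (ρ : Fin n → Matrix ι ι ℂ) (i : Fin n) : Matrix (Fin L → ι) (Fin L → ι) ℂ :=
  (etaL L hn η i)⁻¹ •
    ∑ c ∈ Finset.univ.filter (fun c : Fin L → Fin n => omg L hn c = i), etaC L η c • rhoC L ρ c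

/-- Partial transposition on the `L`-fold bipartite space. -/
def ptL {α β : Type*} (L : ℕ) (σ : Matrix (Fin L → α × β) (Fin L → α × β) ℂ) :
    Matrix (Fin L → α × β) (Fin L → α × β) ℂ :=
  Matrix.of fun x y => σ (fun l => ((x l).1, (y l).2)) (fun l => ((y l).1, (x l).2))

/-- The `L`-fold tensor power of a matrix. -/
def tensorPow {ι κ : Type*} (L : ℕ) (B : Matrix ι κ ℂ) : Matrix (Fin L → ι) (Fin L → κ) ℂ :=
  Matrix.of fun x y => ∏ l, B (x l) (y l)

theorem tensorPow_mul {ι κ μ : Type*} [Fintype κ] (L : ℕ)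
    (A : Matrix ι κ ℂ) (B : Matrix κ μ ℂ) :
    tensorPow L (A * B) = tensorPow L A * tensorPow L B := by
  ext x y
  simp [tensorPow, Matrix.mul_apply, Fintype.prod_sum, Finset.prod_mul_distrib]

theorem tensorPow_conjTranspose {ι κ : Type*} (L : ℕ) (A : Matrix ι κ ℂ) :
    tensorPow L Aᴴ = (tensorPow L A)ᴴ := by
  ext x y
  simp [tensorPow]

theorem tensorPow_diagonal {ι : Type*} [DecidableEq ι] (L : ℕ) (d : ι → ℂ) :
    tensorPow L (Matrix.diagonal d) = Matrix.diagonal fun x => ∏ l, d (x l) := by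
  ext x y
  by_cases h : x = y
  · subst h
    simp [tensorPow]
  · obtain ⟨l, hl⟩ := Function.ne_iff.mp h
    rw [Matrix.diagonal_apply_ne _ h]
    exact Finset.prod_eq_zero (Finset.mem_univ l) (Matrix.diagonal_apply_ne _ hl)

theorem trace_tensorPow {ι : Type*} [Fintype ι] (L : ℕ) (A : Matrix ι ι ℂ) :
    (tensorPow L A).trace = A.trace ^ L := by
  simp [tensorPow, Matrix.trace, Fintype.sum_pow]

/-- Trace pairing of an effect with a matrix factored as `W * Vᴴ`, where `V` is unitary and the
columns of `W` are orthogonal. -/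
theorem norm_trace_mul_le_sum {κ : Type*} [Fintype κ] [DecidableEq κ] {M W V : Matrix κ κ ℂ}
    {d : κ → ℝ} (hM : M.PosSemidef) (hM' : (1 - M).PosSemidef) (hd : ∀ x, 0 ≤ d x)
    (hV : Vᴴ * V = 1) (hW : Wᴴ * W = Matrix.diagonal fun x => ((d x ^ 2 : ℝ) : ℂ)) :
    ‖(W * Vᴴ * M).trace‖ ≤ ∑ x, d x := by
  obtain ⟨N, rfl⟩ : ∃ N : Matrix κ κ ℂ, M = Nᴴ * N := by
    open scoped MatrixOrder in
    exact CStarAlgebra.nonneg_iff_eq_star_mul_self.mp hM.nonneg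
  have key : ∀ (X : Matrix κ κ ℂ) (x : κ),
      ∑ y, ‖(N * X) y x‖ ^ 2 ≤ ((Xᴴ * X) x x).re := by
    intro X x
    have h := (hM'.conjTranspose_mul_mul_same X).diag_nonneg (i := x)
    have e : Xᴴ * (1 - Nᴴ * N) * X = Xᴴ * X - (N * X)ᴴ * (N * X) := by
      rw [Matrix.conjTranspose_mul]
      noncomm_ring
    rw [e, Matrix.sub_apply, sub_nonneg] at h
    refine le_trans (le_of_eq ?_) (Complex.le_def.mp h).1
    rw [Matrix.mul_apply, Complex.re_sum]
    refine Finset.sum_congr rfl fun y _ => ?_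
    rw [Matrix.conjTranspose_apply, Complex.star_def, ← Complex.normSq_eq_conj_mul_self,
      Complex.ofReal_re, Complex.normSq_eq_norm_sq]
  have e : (W * Vᴴ * (Nᴴ * N)).trace = ((N * V)ᴴ * (N * W)).trace := by
    rw [Matrix.mul_assoc, Matrix.trace_mul_comm, Matrix.conjTranspose_mul]
    simp only [Matrix.mul_assoc]
  rw [e]
  refine (norm_sum_le _ _).trans (Finset.sum_le_sum fun x _ => ?_)
  rw [Matrix.diag_apply, Matrix.mul_apply]
  calc _ ≤ ∑ y, ‖(N * V) y x‖ * ‖(N * W) y x‖ := by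
        refine (norm_sum_le _ _).trans (le_of_eq ?_)
        simp
    _ ≤ √(∑ y, ‖(N * V) y x‖ ^ 2) * √(∑ y, ‖(N * W) y x‖ ^ 2) :=
        Real.sum_mul_le_sqrt_mul_sqrt _ _ _
    _ ≤ √1 * √(d x ^ 2) := by
        gcongr
        · simpa [hV] using key V x
        · have h := key W x
          rwa [hW, Matrix.diagonal_apply_eq, Complex.ofReal_re] at h
    _ = d x := by simp [Real.sqrt_sq (hd x)]

/-- A polar-type factorisation together with a contraction attaining the trace norm. -/
theorem exists_factorization {ι : Type*} [Fintype ι] [DecidableEq ι] (B : Matrix ι ι ℂ) :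
    ∃ (U W V : Matrix ι ι ℂ) (s : ι → ℝ), (∀ i, 0 ≤ s i) ∧ (1 - U * Uᴴ).PosSemidef ∧
      Vᴴ * V = 1 ∧ (Wᴴ * W = Matrix.diagonal fun x => ((s x ^ 2 : ℝ) : ℂ)) ∧ B = W * Vᴴ ∧
      (U * B).trace = ((∑ i, s i : ℝ) : ℂ) := by
  have hP := Matrix.posSemidef_conjTranspose_mul_self B
  set V : Matrix ι ι ℂ := hP.isHermitian.eigenvectorUnitary.1 with hVdef
  have hV : Vᴴ * V = 1 := Unitary.coe_star_mul_self hP.isHermitian.eigenvectorUnitary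
  have hV' : V * Vᴴ = 1 := Unitary.coe_mul_star_self hP.isHermitian.eigenvectorUnitary
  have hspec : Bᴴ * B = V * Matrix.diagonal (fun i => (hP.isHermitian.eigenvalues i : ℂ)) * Vᴴ := by
    conv_lhs => rw [hP.isHermitian.spectral_theorem, Unitary.conjStarAlgAut_apply]
    rfl
  have hnn := hP.eigenvalues_nonneg
  generalize hP.isHermitian.eigenvalues = ev at hspec hnn
  have hev : ∀ i, ev i = √(ev i) ^ 2 := fun i => (Real.sq_sqrt (hnn i)).symm
  have hs : ∀ i, 0 ≤ √(ev i) := fun i => Real.sqrt_nonneg _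
  generalize hsdef : (fun i => √(ev i)) = s at *
  have hsdef' : ∀ i, √(ev i) = s i := fun i => congrFun hsdef i
  simp only [hsdef'] at hev hs
  have hW : (B * V)ᴴ * (B * V) = Matrix.diagonal fun x => ((s x ^ 2 : ℝ) : ℂ) := by
    calc (B * V)ᴴ * (B * V) = Vᴴ * (Bᴴ * B) * V := by
          rw [Matrix.conjTranspose_mul]; simp only [Matrix.mul_assoc]
      _ = (Vᴴ * V) * Matrix.diagonal (fun i => (ev i : ℂ)) * (Vᴴ * V) := by
          rw [hspec]; simp only [Matrix.mul_assoc]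
      _ = _ := by simp [hV, ← hev]
  set D : Matrix ι ι ℂ := Matrix.diagonal fun i => (((s i)⁻¹ : ℝ) : ℂ) with hD
  have hDH : Dᴴ = D := by
    rw [hD, Matrix.diagonal_conjTranspose]
    congr 1
    ext i
    simp
  refine ⟨V * D * (B * V)ᴴ, B * V, V, s, hs, ?_, hV, hW, ?_, ?_⟩
  · have e : 1 - V * D * (B * V)ᴴ * (V * D * (B * V)ᴴ)ᴴ =
        V * Matrix.diagonal (fun i => ((1 - (s i)⁻¹ * (s i ^ 2 * (s i)⁻¹) : ℝ) : ℂ)) * Vᴴ := by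
      calc _ = V * Vᴴ - V * (D * (((B * V)ᴴ * (B * V)) * D)) * Vᴴ := by
            rw [hV']
            simp only [Matrix.conjTranspose_mul, Matrix.conjTranspose_conjTranspose, hDH,
              Matrix.mul_assoc]
        _ = V * (1 - D * (((B * V)ᴴ * (B * V)) * D)) * Vᴴ := by noncomm_ring
        _ = _ := by
            rw [hW, hD, Matrix.diagonal_mul_diagonal, Matrix.diagonal_mul_diagonal,
              ← Matrix.diagonal_one, Matrix.diagonal_sub]
            congr 3
            ext i
            push_cast
            rfl
    rw [e]
    refine Matrix.PosSemidef.mul_mul_conjTranspose_same (Matrix.posSemidef_diagonal_iff.mpr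
      fun i => ?_) V
    rw [Complex.zero_le_real]
    by_cases h : s i = 0
    · simp [h]
    · exact le_of_eq (by field_simp; simp)
  · rw [Matrix.mul_assoc, hV', Matrix.mul_one]
  · calc (V * D * (B * V)ᴴ * B).trace = (D * ((B * V)ᴴ * (B * V))).trace := by
          rw [Matrix.mul_assoc, Matrix.mul_assoc, Matrix.trace_mul_comm]
          simp only [Matrix.mul_assoc]
      _ = _ := by
          rw [hW, hD, Matrix.diagonal_mul_diagonal, Matrix.trace_diagonal]
          push_cast
          refine Finset.sum_congr rfl fun i _ => ?_
          by_cases h : (s i : ℂ) = 0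
          · simp [h]
          · field_simp

theorem norm_trace_tensorPow_mul_le {ι : Type*} [Fintype ι] [DecidableEq ι] {B W V : Matrix ι ι ℂ}
    {s : ι → ℝ} (hs : ∀ i, 0 ≤ s i) (hV : Vᴴ * V = 1)
    (hW : Wᴴ * W = Matrix.diagonal fun x => ((s x ^ 2 : ℝ) : ℂ)) (hB : B = W * Vᴴ) (L : ℕ)
    {M : Matrix (Fin L → ι) (Fin L → ι) ℂ} (hM : M.PosSemidef) (hM' : (1 - M).PosSemidef) :
    ‖(tensorPow L B * M).trace‖ ≤ (∑ i, s i) ^ L := by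
  rw [hB, tensorPow_mul, tensorPow_conjTranspose, Fintype.sum_pow]
  refine norm_trace_mul_le_sum hM hM' (fun x => Finset.prod_nonneg fun l _ => hs _) ?_ ?_
  · rw [← tensorPow_conjTranspose, ← tensorPow_mul, hV, ← Matrix.diagonal_one, tensorPow_diagonal]
    simp
  · rw [← tensorPow_conjTranspose, ← tensorPow_mul, hW, tensorPow_diagonal]
    simp [Finset.prod_pow]

theorem IsPOVM.one_sub_posSemidef {ι : Type*} [Fintype ι] [DecidableEq ι] {n : ℕ}
    {M : Fin n → Matrix ι ι ℂ} (hM : IsPOVM M) (i : Fin n) : (1 - M i).PosSemidef := by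
  rw [← hM.2, ← Finset.sum_erase_eq_sub (Finset.mem_univ i)]
  exact Matrix.posSemidef_sum _ fun j _ => hM.1 j

/-- If `U` is a contraction, `1 + Re (z U)` is positive semidefinite for every phase `z`. -/
theorem posSemidef_two_add_phase {ι : Type*} [Fintype ι] [DecidableEq ι] {U : Matrix ι ι ℂ}
    (hU : (1 - U * Uᴴ).PosSemidef) {z : ℂ} (hz : z * star z = 1) :
    (1 + 1 + z • U + star z • Uᴴ : Matrix ι ι ℂ).PosSemidef := by
  have hz' : star z * z = 1 := by rwa [mul_comm]
  have e : (1 + 1 + z • U + star z • Uᴴ : Matrix ι ι ℂ) =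
      (1 + star z • Uᴴ)ᴴ * (1 + star z • Uᴴ) + (1 - U * Uᴴ) := by
    simp only [Matrix.conjTranspose_add, Matrix.conjTranspose_one, Matrix.conjTranspose_smul,
      Matrix.conjTranspose_conjTranspose, star_star, Matrix.add_mul, Matrix.mul_add,
      Matrix.one_mul, Matrix.mul_one, Matrix.smul_mul, Matrix.mul_smul, smul_add, smul_smul,
      hz', one_smul]
    abel
  rw [e]
  exact (Matrix.posSemidef_conjTranspose_mul_self _).add hU

/-- Every contraction paired with a nontrivial Fourier component gives a measurement, so the success
probability bounds the pairing. -/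
theorem re_trace_mul_fourier_le {ι : Type*} [Fintype ι] [DecidableEq ι] {n : ℕ} (hn : 0 < n)
    {A : Fin n → Matrix ι ι ℂ} (hA : ∀ j, (A j).IsHermitian) (htr : ∑ j, (A j).trace = 1)
    {Q : ℝ} (hQ : ∀ N : Fin n → Matrix ι ι ℂ, IsPOVM N → ∑ j, ((A j * N j).trace).re ≤ Q)
    {U : Matrix ι ι ℂ} (hU : (1 - U * Uᴴ).PosSemidef) {z : Fin n → ℂ}
    (hz : ∀ j, z j * star (z j) = 1) (hz0 : ∑ j, z j = 0) :
    ((U * ∑ j, z j • A j).trace).re ≤ n * Q - 1 := by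
  have hn' : (0 : ℝ) < n := by exact_mod_cast hn
  have hnC : (n : ℂ) ≠ 0 := by exact_mod_cast hn.ne'
  set N : Fin n → Matrix ι ι ℂ := fun j =>
    ((2 * n : ℝ)⁻¹) • (1 + 1 + z j • U + star (z j) • Uᴴ : Matrix ι ι ℂ) with hN
  have hP : IsPOVM N := by
    refine ⟨fun j => (posSemidef_two_add_phase hU (hz j)).smul (by positivity), ?_⟩
    have hz0' : ∑ j, star (z j) = 0 := by rw [← star_sum, hz0, star_zero]
    rw [hN, ← Finset.smul_sum]
    simp only [Finset.sum_add_distrib, ← Finset.sum_smul, hz0, hz0', zero_smul, add_zero]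
    simp only [Finset.sum_const, Finset.card_univ, Fintype.card_fin]
    ext a b
    simp only [Matrix.smul_apply, Matrix.add_apply]
    simp only [nsmul_eq_mul, Complex.real_smul]
    push_cast
    field_simp
    ring
  have hterm : ∀ j, ((A j * N j).trace).re =
      (n : ℝ)⁻¹ * (((A j).trace).re + (z j * (U * A j).trace).re) := by
    intro j
    have hc : (A j * Uᴴ).trace = star (U * A j).trace := by
      rw [← Matrix.trace_conjTranspose, Matrix.conjTranspose_mul, (hA j).eq]
    have : (A j * N j).trace = ((2 * n : ℝ)⁻¹) • ((A j).trace + (A j).trace +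
        z j * (U * A j).trace + star (z j * (U * A j).trace)) := by
      simp only [hN, Matrix.mul_smul, Matrix.mul_add, Matrix.mul_one, Matrix.trace_smul,
        Matrix.trace_add, hc, Matrix.trace_mul_comm (A j) U, smul_eq_mul, star_mul']
    rw [this, Complex.smul_re, Complex.add_re, Complex.add_re, Complex.add_re, Complex.star_def,
      Complex.conj_re, smul_eq_mul]
    field_simp
    ring
  have h := hQ N hP
  simp only [hterm, ← Finset.mul_sum, Finset.sum_add_distrib, ← Complex.re_sum, htr] at h
  have e : (U * ∑ j, z j • A j).trace = ∑ j, z j * (U * A j).trace := by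
    rw [Matrix.mul_sum, Matrix.trace_sum]
    simp
  rw [e]
  rw [inv_mul_le_iff₀ hn', Complex.one_re] at h
  linarith

/-- The discrete Fourier decomposition of the sum over strings in a residue class. -/
theorem sum_filter_omg_eq {ι : Type*} {n : ℕ} (hn : 0 < n) {ζ : ℂ}
    (hζ : IsPrimitiveRoot ζ n) (L : ℕ) (A : Fin n → Matrix ι ι ℂ) (i : Fin n) :
    (n : ℂ) • ∑ c ∈ Finset.univ.filter (fun c : Fin L → Fin n => omg L hn c = i), rhoC L A c =
      ∑ k ∈ Finset.range n,
        (ζ ^ (k * (n - (i : ℕ)))) • tensorPow L (∑ j : Fin n, (ζ ^ (k * (j : ℕ))) • A j) := by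
  have hexp : ∀ k, tensorPow L (∑ j : Fin n, (ζ ^ (k * (j : ℕ))) • A j) =
      ∑ c : Fin L → Fin n, (ζ ^ (k * ∑ l, (c l : ℕ))) • rhoC L A c := by
    intro k
    ext x y
    simp [tensorPow, rhoC, Matrix.sum_apply, Fintype.prod_sum, Finset.prod_mul_distrib,
      Finset.prod_pow_eq_pow_sum, Finset.mul_sum]
  simp only [hexp, Finset.smul_sum, smul_smul]
  rw [Finset.sum_comm, Finset.sum_filter]
  refine Finset.sum_congr rfl fun c _ => ?_
  rw [← Finset.sum_smul]
  have e : ∑ k ∈ Finset.range n, ζ ^ (k * (n - (i : ℕ))) * ζ ^ (k * ∑ l, (c l : ℕ)) =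
      ∑ k ∈ Finset.range n, (ζ ^ ((n - (i : ℕ)) + ∑ l, (c l : ℕ))) ^ k := by
    refine Finset.sum_congr rfl fun k _ => ?_
    rw [← pow_add, ← pow_mul]
    ring_nf
  have hiff : omg L hn c = i ↔ n ∣ (n - (i : ℕ)) + ∑ l, (c l : ℕ) := by
    have hi := i.2
    rw [omg, Fin.ext_iff]
    have := Nat.modEq_iff_dvd (n := n) (a := i) (b := ∑ l, (c l : ℕ))
    rw [Nat.ModEq, Nat.mod_eq_of_lt hi] at this
    simp only
    rw [eq_comm, this, ← Int.natCast_dvd_natCast, Nat.cast_add, Nat.cast_sub hi.le,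
      ← dvd_add_right (dvd_refl (n : ℤ))]
    ring_nf
  rw [e]
  split_ifs with h
  · rw [(hζ.pow_eq_one_iff_dvd _).mpr (hiff.mp h)]
    simp
  · have h1 : ζ ^ ((n - (i : ℕ)) + ∑ l, (c l : ℕ)) ≠ 1 := fun h' =>
      h (hiff.mpr ((hζ.pow_eq_one_iff_dvd _).mp h'))
    have h2 := mul_geom_sum (ζ ^ ((n - (i : ℕ)) + ∑ l, (c l : ℕ))) n
    rw [← pow_mul, mul_comm _ n, pow_mul, hζ.pow_eq_one, one_pow, sub_self] at h2
    rw [(mul_eq_zero.mp h2).resolve_left (sub_ne_zero.mpr h1), zero_smul]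

theorem ptAB_isHermitian {α β : Type*} {ρ : Matrix (α × β) (α × β) ℂ} (hρ : ρ.IsHermitian) :
    (ptAB ρ).IsHermitian := by
  ext p q
  exact hρ.apply _ _

theorem trace_ptAB {α β : Type*} [Fintype α] [Fintype β] (ρ : Matrix (α × β) (α × β) ℂ) :
    (ptAB ρ).trace = ρ.trace := rfl

theorem etaL_smul_ptL_rhoL {α β : Type*} {n : ℕ} (L : ℕ) (hn : 0 < n) {η : Fin n → ℝ}
    (hη : ∀ i, 0 < η i) (ρ : Fin n → Matrix (α × β) (α × β) ℂ) (i : Fin n) :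
    etaL L hn η i • ptL L (rhoL L hn η ρ i) =
      ∑ c ∈ Finset.univ.filter (fun c : Fin L → Fin n => omg L hn c = i),
        rhoC L (fun j => η j • ptAB (ρ j)) c := by
  have hpos : ∀ c : Fin L → Fin n, 0 < etaC L η c := fun c => Finset.prod_pos fun l _ => hη _
  have hsum : etaL L hn η i • rhoL L hn η ρ i =
      ∑ c ∈ Finset.univ.filter (fun c : Fin L → Fin n => omg L hn c = i),
        etaC L η c • rhoC L ρ c := by
    rw [rhoL, smul_smul]
    rcases (Finset.univ.filter (fun c : Fin L → Fin n => omg L hn c = i)).eq_empty_or_nonempty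
      with h | h
    · rw [h]
      simp
    · have hne : etaL L hn η i ≠ 0 := (Finset.sum_pos (fun c _ => hpos c) h).ne'
      rw [mul_inv_cancel₀ hne, one_smul]
  ext x y
  have := congrFun (congrFun hsum fun l => ((x l).1, (y l).2)) fun l => ((y l).1, (x l).2)
  rw [Matrix.smul_apply] at this ⊢
  refine this.trans ?_
  simp [Matrix.sum_apply, rhoC, etaC, ptAB, Finset.prod_mul_distrib]

/-- The success probability differs from the uniform guess by exponentially small terms. -/
theorem abs_sum_sub_le {ι : Type*} [Fintype ι] [DecidableEq ι] {n : ℕ} (hn : 0 < n)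
    {A : Fin n → Matrix ι ι ℂ} (hA : ∀ j, (A j).IsHermitian) (htr : ∑ j, (A j).trace = 1)
    {Q : ℝ} (hQ : ∀ N : Fin n → Matrix ι ι ℂ, IsPOVM N → ∑ j, ((A j * N j).trace).re ≤ Q)
    (L : ℕ) {M : Fin n → Matrix (Fin L → ι) (Fin L → ι) ℂ} (hM : IsPOVM M) :
    |∑ i, (((∑ c ∈ Finset.univ.filter (fun c : Fin L → Fin n => omg L hn c = i),
      rhoC L A c) * M i).trace).re - 1 / n| ≤ n * |n * Q - 1| ^ L := by
  obtain ⟨ζ, hζ⟩ : ∃ ζ : ℂ, IsPrimitiveRoot ζ n := ⟨_, Complex.isPrimitiveRoot_exp n hn.ne'⟩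
  have hnC : (n : ℂ) ≠ 0 := by exact_mod_cast hn.ne'
  have hn' : (0 : ℝ) < n := by exact_mod_cast hn
  have hnorm : ‖ζ‖ = 1 := hζ.norm'_eq_one hn.ne'
  set B : ℕ → Matrix ι ι ℂ := fun k => ∑ j : Fin n, (ζ ^ (k * (j : ℕ))) • A j with hB
  have hbound : ∀ k ∈ (Finset.range n).erase 0, ∀ i,
      ‖(tensorPow L (B k) * M i).trace‖ ≤ |n * Q - 1| ^ L := by
    intro k hk i
    rw [Finset.mem_erase, Finset.mem_range] at hk
    obtain ⟨U, W, V, s, hs, hU, hV, hW, hBk, hUB⟩ := exists_factorization (B k)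
    refine (norm_trace_tensorPow_mul_le hs hV hW hBk L (hM.1 i) (hM.one_sub_posSemidef i)).trans ?_
    refine pow_le_pow_left₀ (Finset.sum_nonneg fun i _ => hs i) (le_trans ?_ (le_abs_self _)) L
    have h := re_trace_mul_fourier_le hn hA htr hQ hU (z := fun j => ζ ^ (k * (j : ℕ))) ?_ ?_
    · change ((U * B k).trace).re ≤ _ at h
      rwa [hUB, Complex.ofReal_re] at h
    · intro j
      rw [Complex.star_def, Complex.mul_conj, Complex.normSq_eq_norm_sq, norm_pow, hnorm]
      simp
    · have h1 : ζ ^ k ≠ 1 := fun h => hk.1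
        (Nat.eq_zero_of_dvd_of_lt ((hζ.pow_eq_one_iff_dvd k).mp h) hk.2)
      have h2 := mul_geom_sum (ζ ^ k) n
      rw [← pow_mul, mul_comm k, pow_mul, hζ.pow_eq_one, one_pow, sub_self] at h2
      simp only [pow_mul]
      rw [Fin.sum_univ_eq_sum_range (fun j => (ζ ^ k) ^ j)]
      exact (mul_eq_zero.mp h2).resolve_left (sub_ne_zero.mpr h1)
  have hB0 : (B 0).trace = 1 := by
    simp [hB, Matrix.trace_sum, htr]
  have hfour : ∀ i : Fin n, (n : ℂ) * ((∑ c ∈ Finset.univ.filter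
      (fun c : Fin L → Fin n => omg L hn c = i), rhoC L A c) * M i).trace =
      (tensorPow L (B 0) * M i).trace + ∑ k ∈ (Finset.range n).erase 0,
        ζ ^ (k * (n - (i : ℕ))) * (tensorPow L (B k) * M i).trace := by
    intro i
    rw [← smul_eq_mul, ← Matrix.trace_smul, ← Matrix.smul_mul, sum_filter_omg_eq hn hζ,
      ← Finset.add_sum_erase _ _ (Finset.mem_range.mpr hn)]
    simp [Matrix.add_mul, Matrix.sum_mul, Matrix.trace_sum, hB]
  have htot : (n : ℂ) * (∑ i, ((∑ c ∈ Finset.univ.filter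
      (fun c : Fin L → Fin n => omg L hn c = i), rhoC L A c) * M i).trace - 1 / n) =
      ∑ i : Fin n, ∑ k ∈ (Finset.range n).erase 0,
        ζ ^ (k * (n - (i : ℕ))) * (tensorPow L (B k) * M i).trace := by
    rw [mul_sub, Finset.mul_sum, mul_one_div_cancel hnC]
    simp only [hfour, Finset.sum_add_distrib]
    rw [← Matrix.trace_sum, ← Matrix.mul_sum, hM.2, Matrix.mul_one, trace_tensorPow, hB0, one_pow,
      add_sub_cancel_left]
  have hle : ‖(n : ℂ) * (∑ i, ((∑ c ∈ Finset.univ.filter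
      (fun c : Fin L → Fin n => omg L hn c = i), rhoC L A c) * M i).trace - 1 / n)‖ ≤
      n * (n * |n * Q - 1| ^ L) := by
    rw [htot]
    calc _ ≤ ∑ i : Fin n, ∑ k ∈ (Finset.range n).erase 0, |n * Q - 1| ^ L := by
          refine (norm_sum_le _ _).trans (Finset.sum_le_sum fun i _ =>
            (norm_sum_le _ _).trans (Finset.sum_le_sum fun k hk => ?_))
          rw [norm_mul, norm_pow, hnorm, one_pow, one_mul]
          exact hbound k hk i
      _ ≤ _ := by
          simp only [Finset.sum_const, Finset.card_univ, Fintype.card_fin, nsmul_eq_mul]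
          gcongr
          exact (Finset.card_erase_le).trans (Finset.card_range n).le
  rw [norm_mul, Complex.norm_natCast] at hle
  refine le_trans (le_of_eq_of_le ?_ (Complex.abs_re_le_norm _)) (le_of_mul_le_mul_left hle hn')
  rw [Complex.sub_re, Complex.re_sum, ← Complex.ofReal_natCast, ← Complex.ofReal_one,
    ← Complex.ofReal_div, Complex.ofReal_re]

theorem isPOVM_uniform {κ : Type*} [Fintype κ] [DecidableEq κ] {n : ℕ} (hn : 0 < n) :
    IsPOVM fun _ : Fin n => ((n : ℝ)⁻¹ • (1 : Matrix κ κ ℂ)) := by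
  have hn' : (n : ℝ) ≠ 0 := by exact_mod_cast hn.ne'
  refine ⟨fun _ => Matrix.PosSemidef.one.smul (by positivity), ?_⟩
  rw [Finset.sum_const, Finset.card_univ, Fintype.card_fin, ← Nat.cast_smul_eq_nsmul ℝ, smul_smul,
    mul_inv_cancel₀ hn', one_smul]

theorem stmt4 {α β : Type*} [Fintype α] [DecidableEq α] [Fintype β] [DecidableEq β]
    {n : ℕ} (hn : 2 ≤ n)
    (η : Fin n → ℝ) (ρ : Fin n → Matrix (α × β) (α × β) ℂ)
    (hη : ∀ i, 0 < η i) (hsum : ∑ i, η i = 1)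
    (hρ : ∀ i, (ρ i).PosSemidef ∧ (ρ i).trace = 1)
    (Q : ℝ) (hQlt : Q < 2 / n)
    (hQ : ∀ N : Fin n → Matrix (α × β) (α × β) ℂ, IsPOVM N →
      ∑ i, η i * ((ptAB (ρ i) * N i).trace).re ≤ Q) :
    Filter.Tendsto
      (fun L : ℕ =>
        sSup {x : ℝ | ∃ M : Fin n → Matrix (Fin L → α × β) (Fin L → α × β) ℂ, IsPOVM M ∧
          x = ∑ i, etaL L (by omega) η i *
            ((ptL L (rhoL L (by omega) η ρ i) * M i).trace).re})
      Filter.atTop (nhds (1 / n)) := by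
  have hn0 : 0 < n := by omega
  have hn' : (0 : ℝ) < n := by exact_mod_cast hn0
  set A : Fin n → Matrix (α × β) (α × β) ℂ := fun j => η j • ptAB (ρ j) with hAdef
  have hA : ∀ j, (A j).IsHermitian := fun j => by
    have h := ptAB_isHermitian (hρ j).1.isHermitian
    rw [Matrix.IsHermitian, hAdef, Matrix.conjTranspose_smul, h.eq, star_trivial]
  have htr : ∑ j, (A j).trace = 1 := by
    simp only [hAdef, Matrix.trace_smul, trace_ptAB, (hρ _).2, Complex.real_smul, mul_one]
    exact_mod_cast hsum
  have hQ' : ∀ N : Fin n → Matrix (α × β) (α × β) ℂ, IsPOVM N →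
      ∑ j, ((A j * N j).trace).re ≤ Q := fun N hN => by
    refine le_of_eq_of_le (Finset.sum_congr rfl fun j _ => ?_) (hQ N hN)
    rw [hAdef, Matrix.smul_mul, Matrix.trace_smul, Complex.smul_re, smul_eq_mul]
  have hval : ∀ (L : ℕ) (M : Fin n → Matrix (Fin L → α × β) (Fin L → α × β) ℂ), IsPOVM M →
      |∑ i, etaL L hn0 η i * ((ptL L (rhoL L hn0 η ρ i) * M i).trace).re - 1 / n| ≤
        n * |n * Q - 1| ^ L := fun L M hM => by
    refine le_of_eq_of_le ?_ (abs_sum_sub_le hn0 hA htr hQ' L hM)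
    congr 2
    refine Finset.sum_congr rfl fun i _ => ?_
    rw [hAdef, ← etaL_smul_ptL_rhoL L hn0 hη, Matrix.smul_mul, Matrix.trace_smul, Complex.smul_re,
      smul_eq_mul]
  have hr : |n * Q - 1| < 1 := by
    have h1 : 1 / n ≤ Q := by
      have h := hQ' _ (isPOVM_uniform hn0)
      simp only [Matrix.mul_smul, Matrix.mul_one, Matrix.trace_smul, Complex.smul_re,
        ← Finset.smul_sum, ← Complex.re_sum, htr] at h
      simpa using h
    rw [div_le_iff₀ hn'] at h1
    rw [lt_div_iff₀ hn'] at hQlt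
    rw [abs_lt]
    constructor <;> linarith
  have hlim : Filter.Tendsto (fun L : ℕ => (n : ℝ) * |n * Q - 1| ^ L) Filter.atTop (nhds 0) := by
    simpa using (tendsto_pow_atTop_nhds_zero_of_lt_one (abs_nonneg _) hr).const_mul (n : ℝ)
  rw [tendsto_iff_dist_tendsto_zero]
  refine squeeze_zero (fun _ => dist_nonneg) (fun L => ?_) hlim
  rw [Real.dist_eq, abs_le]
  have hmem := isPOVM_uniform (κ := Fin L → α × β) hn0
  constructor
  · have h := (abs_le.mp (hval L _ hmem)).1
    refine h.trans (sub_le_sub_right (le_csSup ?_ ?_) _)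
    on_goal 2 => exact ⟨_, hmem, rfl⟩
    refine ⟨1 / n + n * |n * Q - 1| ^ L, ?_⟩
    rintro x ⟨M, hM, rfl⟩
    linarith [(abs_le.mp (hval L M hM)).2]
  · rw [sub_le_iff_le_add]
    refine csSup_le ⟨_, _, hmem, rfl⟩ ?_
    rintro x ⟨M, hM, rfl⟩
    linarith [(abs_le.mp (hval L M hM)).2]
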